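/- Let k ∈ ℕ with k ≥ 2. Every maximal k-thin set T ⊆ ℤ₂^ω is neither a Borel subset nor a meager subset of the Cantor cube. -/

import Mathlib

open MeasureTheory

/-- The Cantor cube `ℤ₂^ω`, modeled as infinite binary sequences. -/
abbrev Cantor := ℕ → Bool

/-- The (possibly infinite) Hamming distance between two infinite binary sequences. -/
noncomputable def hd (x y : Cantor) : ℕ∞ := {n : ℕ | x n ≠ y n}.encard

/-- `T` is `k`-thin: `hd x y ≥ k` for all distinct `x, y ∈ T`. -/
def IsKThin (k : ℕ) (T : Set Cantor) : Prop :=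
  ∀ x ∈ T, ∀ y ∈ T, x ≠ y → (k : ℕ∞) ≤ hd x y

open Filter Topology

/-- Flipping the coordinates in a finite set, as a self-homeomorphism of the Cantor cube. -/
def flipHomeomorph (F : Finset ℕ) : Cantor ≃ₜ Cantor where
  toFun x n := xor (x n) (decide (n ∈ F))
  invFun x n := xor (x n) (decide (n ∈ F))
  left_inv x := by ext n; simp
  right_inv x := by ext n; simp
  continuous_toFun := continuous_pi fun n =>
    (continuous_of_discreteTopology (f := fun b : Bool => xor b (decide (n ∈ F)))).comp
      (continuous_apply n)
  continuous_invFun := continuous_pi fun n =>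
    (continuous_of_discreteTopology (f := fun b : Bool => xor b (decide (n ∈ F)))).comp
      (continuous_apply n)

lemma flipHomeomorph_apply (F : Finset ℕ) (x : Cantor) (n : ℕ) :
    flipHomeomorph F x n = xor (x n) (decide (n ∈ F)) := rfl

lemma hd_self (x : Cantor) : hd x x = 0 := by simp [hd]

lemma hd_comm (x y : Cantor) : hd x y = hd y x := by simp only [hd, ne_comm]

lemma hd_flipHomeomorph (F : Finset ℕ) (x : Cantor) : hd x (flipHomeomorph F x) = F.card := by
  have h : {n : ℕ | x n ≠ flipHomeomorph F x n} = F := by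
    ext n
    by_cases hn : n ∈ F <;> simp [flipHomeomorph_apply, hn]
  rw [hd, h, Set.encard_coe_eq_coe_finsetCard]

lemma exists_flipHomeomorph_eq {x y : Cantor} (h : hd x y ≠ ⊤) :
    ∃ F, flipHomeomorph F x = y := by
  have hfin : {n : ℕ | x n ≠ y n}.Finite := Set.encard_ne_top_iff.1 h
  refine ⟨hfin.toFinset, ?_⟩
  ext n
  rw [flipHomeomorph_apply]
  cases hx : x n <;> cases hy : y n <;> simp [hx, hy]

/-- A maximal `k`-thin set with `k ≥ 1` is a `(k - 1)`-net. -/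
lemma exists_hd_lt_of_maximal {k : ℕ} (hk : 1 ≤ k) {T : Set Cantor} (hthin : IsKThin k T)
    (hmax : ∀ S : Set Cantor, IsKThin k S → T ⊆ S → S = T) (x : Cantor) :
    ∃ t ∈ T, hd x t < k := by
  by_contra! h
  have hS : IsKThin k (insert x T) := by
    rintro a (rfl | ha) b (rfl | hb) hab
    · exact absurd rfl hab
    · exact h b hb
    · exact hd_comm b a ▸ h a ha
    · exact hthin a ha b hb hab
  have hxT : x ∈ T := hmax _ hS (Set.subset_insert x T) ▸ Set.mem_insert x T
  have h0 := h x hxT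
  rw [hd_self] at h0
  have : k = 0 := by simpa using h0
  omega

lemma not_isMeagre_of_maximal {k : ℕ} (hk : 1 ≤ k) {T : Set Cantor} (hthin : IsKThin k T)
    (hmax : ∀ S : Set Cantor, IsKThin k S → T ⊆ S → S = T) : ¬ IsMeagre T := by
  intro hT
  have hU : IsMeagre (⋃ F : Finset ℕ, flipHomeomorph F ⁻¹' T) :=
    isMeagre_iUnion fun F =>
      hT.preimage_of_isOpenMap (flipHomeomorph F).continuous (flipHomeomorph F).isOpenMap
  refine not_isMeagre_of_isOpen isOpen_univ Set.univ_nonempty (hU.mono fun x _ => ?_)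
  obtain ⟨t, ht, hlt⟩ := exists_hd_lt_of_maximal hk hthin hmax x
  obtain ⟨F, hF⟩ := exists_flipHomeomorph_eq hlt.ne_top
  exact Set.mem_iUnion.2 ⟨F, by rwa [Set.mem_preimage, hF]⟩

lemma tendsto_flipHomeomorph_singleton (x : Cantor) :
    Tendsto (fun n => flipHomeomorph {n} x) atTop (𝓝 x) := by
  refine tendsto_pi_nhds.2 fun m => tendsto_nhds_of_eventually_eq ?_
  filter_upwards [eventually_gt_atTop m] with n hn
  simp [flipHomeomorph_apply, hn.ne]

/-- A category analogue of the Steinhaus theorem: a nonmeagre set with the Baire property contains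
two points that differ in exactly one coordinate. -/
lemma BaireMeasurableSet.exists_mem_flipHomeomorph_mem {T : Set Cantor}
    (hT : BaireMeasurableSet T) (hne : ¬ IsMeagre T) :
    ∃ n, ∃ x ∈ T, flipHomeomorph {n} x ∈ T := by
  obtain ⟨U, hU, hTU⟩ := hT.residualEq_isOpen
  have hUne : U.Nonempty := by
    rw [Set.nonempty_iff_ne_empty]
    rintro rfl
    refine hne ?_
    filter_upwards [hTU.mem_iff] with x hx using fun h => hx.1 h
  obtain ⟨x, hx⟩ := hUne
  obtain ⟨n, hn⟩ := ((tendsto_flipHomeomorph_singleton x).eventually (hU.mem_nhds hx)).exists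
  have hres := hTU.mem_iff
  have hpre : ∀ᶠ y in residual Cantor, flipHomeomorph {n} y ∈ T ↔ flipHomeomorph {n} y ∈ U :=
    (tendsto_residual_of_isOpenMap (flipHomeomorph {n}).continuous
      (flipHomeomorph {n}).isOpenMap).eventually hres
  obtain ⟨y, ⟨hyU, hyU'⟩, hy, hy'⟩ := (dense_of_mem_residual (hres.and hpre)).inter_open_nonempty
    (U ∩ flipHomeomorph {n} ⁻¹' U) (hU.inter (hU.preimage (flipHomeomorph {n}).continuous))
    ⟨x, hx, hn⟩
  exact ⟨n, y, hy.2 hyU, hy'.2 hyU'⟩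

/-- For `k ≥ 2`, maximal `k`-thin sets are neither Borel nor meager. -/
theorem maximal_kThin_not_borel_not_meager (k : ℕ) (hk : 2 ≤ k) (T : Set Cantor)
    (hthin : IsKThin k T)
    (hmax : ∀ S : Set Cantor, IsKThin k S → T ⊆ S → S = T) :
    ¬ MeasurableSet[borel Cantor] T ∧ ¬ IsMeagre T := by
  have hne := not_isMeagre_of_maximal (by omega) hthin hmax
  refine ⟨fun hT => ?_, hne⟩
  borelize Cantor
  obtain ⟨n, x, hx, hx'⟩ :=
    (MeasurableSet.baireMeasurableSet hT).exists_mem_flipHomeomorph_mem hne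
  have hd1 := hd_flipHomeomorph {n} x
  have hxne : x ≠ flipHomeomorph {n} x := by
    intro h
    rw [← h, hd_self] at hd1
    simp at hd1
  have hle := hthin x hx _ hx' hxne
  rw [hd1, Nat.cast_le, Finset.card_singleton] at hle
  omega
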